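/- Let A ⊆ F_q be a finite set such that |(A+A) ∩ (a·G + b)| ≤ |G|^{1/2} for every subfield G of F_q, every a ∈ F_q∖{0}, and every b ∈ F_q. Then |A + A²| ≫ |A|^{1 + 1/84}, where A + A² = {a + b² : a, b ∈ A}. -/

import Mathlib

open Pointwise Finset

/-- collisions of the map sending a pair (b, c) to b + ξ c -/
def collisions {F : Type} [Field F] [DecidableEq F] (B : Finset F) (ξ : F) : Finset ((F × F) × (F × F)) :=
  ((B ×ˢ B) ×ˢ (B ×ˢ B)).filter (fun x => x.1.1 + ξ * x.2.1 = x.1.2 + ξ * x.2.2)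

lemma card_sq_le_collisions {F : Type} [Field F] [DecidableEq F] (B : Finset F) (ξ : F) (hξ : ξ ≠ 0) :
    #B ^ 2 * #B ^ 2 ≤ #(B + ξ • B) * #(collisions B ξ) := by
  have h := le_card_add_mul_addEnergy B (ξ • B)
  rw [card_smul_finset₀ hξ] at h
  refine h.trans (Nat.mul_le_mul_left _ ?_)
  unfold addEnergy
  have : (((B ×ˢ B) ×ˢ (ξ • B) ×ˢ (ξ • B)).filter fun x => x.1.1 + x.2.1 = x.1.2 + x.2.2) ⊆
      (collisions B ξ).image (fun x => ((x.1.1, x.1.2), (ξ * x.2.1, ξ * x.2.2))) := by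
    rintro ⟨⟨a, b⟩, ⟨c, d⟩⟩ hx
    simp only [mem_filter, mem_product, mem_smul_finset, smul_eq_mul] at hx
    obtain ⟨⟨⟨ha, hb⟩, ⟨c', hc, rfl⟩, ⟨d', hd, rfl⟩⟩, he⟩ := hx
    refine mem_image.2 ⟨((a, b), (c', d')), ?_, rfl⟩
    simp only [collisions, mem_filter, mem_product]
    exact ⟨⟨⟨ha, hb⟩, hc, hd⟩, he⟩
  exact (card_le_card this).trans card_image_le

lemma sum_collisions {F : Type} [Field F] [DecidableEq F] (B Γ : Finset F) :
    ∑ ξ ∈ Γ, #(collisions B ξ) ≤ #Γ * #B ^ 2 + #B ^ 4 := by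
  set U := (B ×ˢ B) ×ˢ (B ×ˢ B) with hU
  set D := U.filter (fun x => x.1.1 = x.1.2 ∧ x.2.1 = x.2.2) with hD
  have h1 : ∑ ξ ∈ Γ, #(collisions B ξ)
      = ∑ x ∈ U, #(Γ.filter (fun ξ => x.1.1 + ξ * x.2.1 = x.1.2 + ξ * x.2.2)) := by
    simp only [collisions, card_filter]
    rw [sum_comm]
  rw [h1]
  have h2 : ∀ x ∈ U, #(Γ.filter (fun ξ => x.1.1 + ξ * x.2.1 = x.1.2 + ξ * x.2.2)) ≤
      (if x.1.1 = x.1.2 ∧ x.2.1 = x.2.2 then #Γ else 0) + 1 := by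
    intro x _
    split_ifs with h
    · exact (card_filter_le _ _).trans (Nat.le_succ _)
    · rw [zero_add, card_le_one]
      intro y hy z hz
      simp only [mem_filter] at hy hz
      by_cases h3 : x.2.1 = x.2.2
      · exfalso; apply h; refine ⟨?_, h3⟩
        have := hy.2; rw [h3] at this; exact add_right_cancel this
      · have h4 : (y - z) * (x.2.1 - x.2.2) = 0 := by linear_combination hy.2 - hz.2
        rcases mul_eq_zero.1 h4 with h5 | h5
        · exact sub_eq_zero.1 h5
        · exact absurd (sub_eq_zero.1 h5) h3
  refine (sum_le_sum h2).trans ?_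
  rw [sum_add_distrib, ← sum_filter]
  simp only [sum_const, smul_eq_mul, mul_one]
  have h3 : #D ≤ #B ^ 2 := by
    have : D ⊆ (B ×ˢ B).image (fun p => ((p.1, p.1), (p.2, p.2))) := by
      rintro ⟨⟨a, b⟩, ⟨c, d⟩⟩ hx
      simp only [hD, hU, mem_filter, mem_product] at hx
      obtain ⟨⟨⟨ha, hb⟩, hc, hd⟩, rfl, rfl⟩ := hx
      exact mem_image.2 ⟨(a, c), by simp [ha, hc], rfl⟩
    refine (card_le_card this).trans (card_image_le.trans ?_)
    rw [card_product, sq]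
  have h4 : #U = #B ^ 4 := by simp only [hU, card_product]; ring
  rw [h4, mul_comm #Γ]
  exact Nat.add_le_add_right (Nat.mul_le_mul_right _ h3) _

lemma exists_large_dilate {F : Type} [Field F] [DecidableEq F] (B Γ : Finset F) (h0 : (0 : F) ∉ Γ)
    (hΓ : Γ.Nonempty) (hB : B.Nonempty) (h : #B ^ 2 ≤ 2 * #Γ) :
    ∃ ξ ∈ Γ, #B ^ 2 ≤ 4 * #(B + ξ • B) := by
  by_contra! hc
  have hBp : 0 < #B ^ 2 := by have := hB.card_pos; positivity
  have h1 : ∀ ξ ∈ Γ, 4 * #B ^ 2 ≤ #(collisions B ξ) := by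
    intro ξ hξ
    have h2 := card_sq_le_collisions B ξ (fun h => h0 (h ▸ hξ))
    have h3 := hc ξ hξ
    by_contra! h4
    have h5 : 4 * (#(B + ξ • B) * #(collisions B ξ)) ≤ #B ^ 2 * #(collisions B ξ) := by
      rw [← mul_assoc]; exact Nat.mul_le_mul_right _ h3.le
    have h6 : #B ^ 2 * #(collisions B ξ) < #B ^ 2 * (4 * #B ^ 2) := Nat.mul_lt_mul_of_pos_left h4 hBp
    nlinarith
  have h2 := (sum_le_sum h1).trans (sum_collisions B Γ)
  simp only [sum_const, smul_eq_mul] at h2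
  have h3 : #B ^ 4 ≤ 2 * #Γ * #B ^ 2 := by
    calc #B ^ 4 = #B ^ 2 * #B ^ 2 := by ring
      _ ≤ _ := Nat.mul_le_mul_right _ h
  have h4 : 0 < #Γ * #B ^ 2 := Nat.mul_pos hΓ.card_pos hBp
  nlinarith

/-- the quotient set -/
def quot {F : Type} [Field F] (B : Finset F) : Set F :=
  {x | ∃ a ∈ B, ∃ b ∈ B, ∃ c ∈ B, ∃ d ∈ B, c ≠ d ∧ x = (a - b) / (c - d)}

lemma card_of_not_quot {F : Type} [Field F] [DecidableEq F] (B : Finset F) (u v : F) (hv : v ≠ 0)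
    (h : u / v ∉ quot B) : #B ^ 2 ≤ #(u • B + v • B) := by
  have : #((B ×ˢ B).image (fun p => u * p.1 + v * p.2)) = #(B ×ˢ B) := by
    apply card_image_of_injOn
    rintro ⟨a, b⟩ hab ⟨c, d⟩ hcd he
    simp only [coe_product, Set.mem_prod, mem_coe] at hab hcd he
    by_cases hac : a = c
    · subst hac
      have : v * b = v * d := add_left_cancel he
      rw [mul_left_cancel₀ hv this]
    · exfalso; apply h
      refine ⟨d, hcd.2, b, hab.2, a, hab.1, c, hcd.1, hac, ?_⟩
      rw [div_eq_div_iff hv (sub_ne_zero.2 hac)]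
      linear_combination he
  rw [sq, ← card_product, ← this]
  apply card_le_card
  intro x hx
  obtain ⟨⟨a, b⟩, hp, rfl⟩ := mem_image.1 hx
  rw [mem_product] at hp
  exact add_mem_add (smul_mem_smul_finset hp.1) (smul_mem_smul_finset hp.2)

lemma pivot {F : Type} [Field F] [Fintype F] [DecidableEq F] (B : Finset F) (P : Set F)
    (hB : 2 ≤ #B) (hP : ∀ a ∈ B, ∀ b ∈ B, ∃ p ∈ P, ∃ q ∈ P, a - b = p - q)
    (hG : ∀ (G : Subfield F) (a b : F), a ≠ 0 → (∀ x ∈ B, ∃ g ∈ G, x = a * g + b) →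
      #B ^ 2 ≤ Nat.card G)
    (h1 : ∀ p ∈ P, ∀ q ∈ P, ∀ p' ∈ P, ∀ q' ∈ P,
      4 * #((p - q) • B + (p' - q') • B) < #B ^ 2)
    (h2 : ∀ p ∈ P, ∀ q ∈ P, ∀ p' ∈ P, ∀ q' ∈ P,
      #((p - q + (p' - q')) • B + (p' - q') • B) < #B ^ 2)
    (h3 : ∀ p ∈ P, ∀ q ∈ P, ∀ p' ∈ P, ∀ q' ∈ P, ∀ s ∈ P, ∀ t ∈ P,
      #((s * (p - q)) • B + (t * (p' - q')) • B) < #B ^ 2) : False := by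
  obtain ⟨b0, hb0, b1, hb1, hne⟩ := one_lt_card.1 (show 1 < #B from hB)
  have hd0 : b1 - b0 ≠ 0 := sub_ne_zero.2 hne.symm
  obtain ⟨s0, hs0, hs0n⟩ : ∃ s0 ∈ P, s0 ≠ 0 := by
    obtain ⟨p, hp, q, hq, he⟩ := hP b1 hb1 b0 hb0
    by_cases hp0 : p = 0
    · refine ⟨q, hq, ?_⟩
      rintro rfl
      apply hd0; rw [he, hp0, sub_zero]
    · exact ⟨p, hp, hp0⟩
  set R := quot B with hR
  have zeroR : (0 : F) ∈ R := ⟨b0, hb0, b0, hb0, b0, hb0, b1, hb1, hne, by simp⟩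
  have negR : ∀ r ∈ R, -r ∈ R := by
    rintro r ⟨a, ha, b, hb, c, hc, d, hd, hcd, rfl⟩
    exact ⟨b, hb, a, ha, c, hc, d, hd, hcd, by ring⟩
  have oneR : ∀ r ∈ R, r + 1 ∈ R := by
    rintro r ⟨a, ha, b, hb, c, hc, d, hd, hcd, rfl⟩
    by_contra hn
    have hcd' := sub_ne_zero.2 hcd
    have he : (a - b) / (c - d) + 1 = (a - b + (c - d)) / (c - d) := by field_simp
    rw [he] at hn
    have := card_of_not_quot B _ _ hcd' hn
    obtain ⟨p, hp, q, hq, e1⟩ := hP a ha b hb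
    obtain ⟨p', hp', q', hq', e2⟩ := hP c hc d hd
    rw [e1, e2] at this
    exact absurd this (not_le.2 (h2 p hp q hq p' hp' q' hq'))
  let M : Submonoid F :=
    { carrier := {x | ∀ r ∈ R, x * r ∈ R}
      one_mem' := by intro r hr; simpa using hr
      mul_mem' := by
        intro x y hx hy r hr
        rw [mul_assoc]; exact hx _ (hy _ hr) }
  have hPM : ∀ p ∈ P, p / s0 ∈ M := by
    rintro s hs r ⟨a, ha, b, hb, c, hc, d, hd, hcd, rfl⟩
    by_contra hn
    have hcd' := sub_ne_zero.2 hcd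
    have he : s / s0 * ((a - b) / (c - d)) = (s * (a - b)) / (s0 * (c - d)) := by field_simp
    rw [he] at hn
    have := card_of_not_quot B _ _ (mul_ne_zero hs0n hcd') hn
    obtain ⟨p, hp, q, hq, e1⟩ := hP a ha b hb
    obtain ⟨p', hp', q', hq', e2⟩ := hP c hc d hd
    rw [e1, e2] at this
    exact absurd this (not_le.2 (h3 p hp q hq p' hp' q' hq' s hs s0 hs0))
  have invpow : ∀ x : F, x ≠ 0 → x⁻¹ = x ^ (Fintype.card F - 2) := by
    intro x hx
    have hc : 1 < Fintype.card F := Fintype.one_lt_card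
    have := FiniteField.pow_card_sub_one_eq_one x hx
    rw [show Fintype.card F - 1 = (Fintype.card F - 2) + 1 by omega, pow_succ] at this
    exact (eq_inv_of_mul_eq_one_left this).symm
  have hMH : ∀ x ∈ M, ∀ r ∈ R, r + x ∈ R := by
    intro x hx r hr
    by_cases h0 : x = 0
    · simpa [h0] using hr
    · have hi : x⁻¹ ∈ M := by rw [invpow x h0]; exact pow_mem hx _
      have := hx _ (oneR _ (hi r hr))
      rwa [mul_add, mul_one, mul_inv_cancel_left₀ h0] at this
  set Z : Set F := (fun p => p / s0) '' P with hZ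
  have hZM : Submonoid.closure Z ≤ M := by
    rw [Submonoid.closure_le]
    rintro _ ⟨p, hp, rfl⟩
    exact hPM p hp
  have hGH : ∀ x ∈ Subring.closure Z, ∀ r ∈ R, r + x ∈ R := by
    intro x hx
    rw [Subring.mem_closure_iff] at hx
    induction hx using AddSubgroup.closure_induction with
    | mem x hx => exact hMH x (hZM hx)
    | zero => intro r hr; simpa using hr
    | add x y _ _ hx hy => intro r hr; rw [← add_assoc]; exact hy _ (hx _ hr)
    | neg x _ hx =>
      intro r hr
      have := negR _ (hx _ (negR _ hr))
      rwa [neg_add, neg_neg] at this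
  let G : Subfield F :=
    { Subring.closure Z with
      inv_mem' := by
        intro x hx
        by_cases h0 : x = 0
        · rw [h0, inv_zero]; exact (Subring.closure Z).zero_mem
        · rw [invpow x h0]; exact pow_mem (show x ∈ Subring.closure Z from hx) _ }
  have hGdef : ∀ x, x ∈ G ↔ x ∈ Subring.closure Z := fun x => Iff.rfl
  have hGR : ∀ x ∈ G, x ∈ R := by
    intro x hx
    have := hGH x hx 0 zeroR
    rwa [zero_add] at this
  have hBG : ∀ x ∈ B, ∃ g ∈ G, x = s0 * g + b0 := by
    intro x hx
    obtain ⟨p, hp, q, hq, e⟩ := hP x hx b0 hb0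
    refine ⟨p / s0 - q / s0, ?_, ?_⟩
    · apply sub_mem
      · exact Subring.subset_closure ⟨p, hp, rfl⟩
      · exact Subring.subset_closure ⟨q, hq, rfl⟩
    · field_simp
      linear_combination e
  have hcard := hG G s0 b0 hs0n hBG
  classical
  set Γ : Finset F := (univ.filter (fun x => x ∈ G)).erase 0 with hΓ
  have hc1 : Nat.card G = #Γ + 1 := by
    rw [hΓ, card_erase_add_one (by simp [G.zero_mem]), Nat.card_eq_fintype_card,
      Fintype.card_subtype]
  have h4 : 4 ≤ #B ^ 2 := by nlinarith
  obtain ⟨ξ, hξ, hlarge⟩ := exists_large_dilate B Γ (by simp [hΓ]) (by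
    rw [← card_pos]; omega) (card_pos.1 (by omega)) (by omega)
  have hξG : ξ ∈ G := by
    have := mem_of_mem_erase hξ
    simpa using this
  obtain ⟨a, ha, b, hb, c, hc, d, hd, hcd, rfl⟩ := hGR ξ hξG
  have hcd' := sub_ne_zero.2 hcd
  have he : #(B + ((a - b) / (c - d)) • B) = #((c - d) • B + (a - b) • B) := by
    rw [← card_smul_finset₀ hcd' (B + _), smul_add, smul_smul, mul_div_cancel₀ _ hcd']
  obtain ⟨p, hp, q, hq, e1⟩ := hP a ha b hb
  obtain ⟨p', hp', q', hq', e2⟩ := hP c hc d hd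
  rw [he, e1, e2] at hlarge
  exact absurd hlarge (not_le.2 (h1 p' hp' q' hq' p hp q hq))

/-- `p • A` can be exchanged, inside any sum, for `k • W` at the cost of a factor `Q`. -/
def Good {F : Type} [Field F] [DecidableEq F] (A W : Finset F) (Q : ℝ) (k : ℕ) (p : F) : Prop :=
  ∀ X : Finset F, (#(X + p • A) : ℝ) ≤ Q * #(X + k • W)

lemma Good.neg {F : Type} [Field F] [DecidableEq F] {A W : Finset F} {Q : ℝ} {k : ℕ} {p : F}
    (hW : -W = W) (h : Good A W Q k p) : Good A W Q k (-p) := by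
  intro X
  have h1 : #(X + (-p) • A) = #(-X + p • A) := by
    rw [← card_neg (-X + p • A), neg_add, neg_neg]
    congr 2
    ext x; simp [mem_smul_finset, mem_neg', eq_neg_iff_add_eq_zero]
  have h2 : #(X + k • W) = #(-X + k • W) := by
    rw [← card_neg (-X + k • W), neg_add, neg_neg, ← neg_nsmul, hW]
  rw [h1, h2]; exact h _

lemma Good.add {F : Type} [Field F] [DecidableEq F] {A W : Finset F} {Q Q' : ℝ} {k k' : ℕ} {p p' : F}
    (hQ : 0 ≤ Q) (h : Good A W Q k p) (h' : Good A W Q' k' p') :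
    Good A W (Q * Q') (k + k') (p + p') := by
  intro X
  have h1 : X + (p + p') • A ⊆ (X + p' • A) + p • A := by
    intro x hx
    obtain ⟨y, hy, z, hz, rfl⟩ := mem_add.1 hx
    obtain ⟨a, ha, rfl⟩ := mem_smul_finset.1 hz
    rw [add_smul, add_comm (p • a), ← add_assoc]
    exact add_mem_add (add_mem_add hy (smul_mem_smul_finset ha)) (smul_mem_smul_finset ha)
  calc (#(X + (p + p') • A) : ℝ) ≤ #((X + p' • A) + p • A) := by exact_mod_cast card_le_card h1
    _ ≤ Q * #((X + p' • A) + k • W) := h _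
    _ = Q * #((X + k • W) + p' • A) := by rw [add_right_comm]
    _ ≤ Q * (Q' * #((X + k • W) + k' • W)) := mul_le_mul_of_nonneg_left (h' _) hQ
    _ = _ := by rw [add_assoc X, ← add_nsmul, mul_assoc]

lemma Good.sub {F : Type} [Field F] [DecidableEq F] {A W : Finset F} {Q Q' : ℝ} {k k' : ℕ} {p p' : F}
    (hW : -W = W) (hQ : 0 ≤ Q) (h : Good A W Q k p) (h' : Good A W Q' k' p') :
    Good A W (Q * Q') (k + k') (p - p') := by
  rw [sub_eq_add_neg]; exact h.add hQ (h'.neg hW)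

lemma Good.pair {F : Type} [Field F] [DecidableEq F] {A W : Finset F} {Q Q' : ℝ} {k k' : ℕ} {p p' : F}
    (hQ : 0 ≤ Q) (h : Good A W Q k p) (h' : Good A W Q' k' p') :
    (#(p • A + p' • A) : ℝ) ≤ Q * Q' * #((k + k') • W) := by
  calc (#(p • A + p' • A) : ℝ) = #(p' • A + p • A) := by rw [add_comm]
    _ ≤ Q * #(p' • A + k • W) := h _
    _ = Q * #(k • W + p' • A) := by rw [add_comm]
    _ ≤ Q * (Q' * #(k • W + k' • W)) := mul_le_mul_of_nonneg_left (h' _) hQ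
    _ = _ := by rw [← add_nsmul, mul_assoc]

/-- dilates of `S` by a good number -/
lemma Good.dilS {F : Type} [Field F] [DecidableEq F] {A S W : Finset F} {Q L : ℝ} {p : F}
    (hA : A.Nonempty) (hp : p ≠ 0) (hL : 0 ≤ L) (hAS : (#(A + S) : ℝ) ≤ L * #A)
    (h : Good A W Q 1 p) (X : Finset F) : (#(X + p • S) : ℝ) ≤ L * Q * #(X + W) := by
  have h1 := ruzsa_triangle_inequality_add_add_add X (p • A) (p • S)
  rw [← smul_add, card_smul_finset₀ hp, card_smul_finset₀ hp] at h1
  have h1' : (#(X + p • S) : ℝ) * #A ≤ #(X + p • A) * #(A + S) := by exact_mod_cast h1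
  have hA' : (0 : ℝ) < #A := by exact_mod_cast hA.card_pos
  have h2 := h X
  rw [one_nsmul] at h2
  have : (#(X + p • S) : ℝ) * #A ≤ (L * Q * #(X + W)) * #A := by
    calc (#(X + p • S) : ℝ) * #A ≤ #(X + p • A) * #(A + S) := h1'
      _ ≤ #(X + p • A) * (L * #A) := by gcongr
      _ ≤ (Q * #(X + W)) * (L * #A) := by gcongr
      _ = _ := by ring
  exact le_of_mul_le_mul_right this hA'

lemma good_zero {F : Type} [Field F] [DecidableEq F] {A W : Finset F} {Q : ℝ} (hA : A.Nonempty)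
    (hW : W.Nonempty) (hQ : 1 ≤ Q) (k : ℕ) : Good A W Q k 0 := by
  intro X
  rw [zero_smul_finset hA, add_zero]
  have hk : (k • W).Nonempty := hW.nsmul
  have h1 : #X ≤ #(X + k • W) := card_le_card_add_right hk
  have h2 : (#X : ℝ) ≤ #(X + k • W) := by exact_mod_cast h1
  have h3 : (0 : ℝ) ≤ #(X + k • W) := by positivity
  nlinarith

lemma Good.mul {F : Type} [Field F] [DecidableEq F] {A S : Finset F} {Q L : ℝ} {p p' : F}
    (hA : A.Nonempty) (hS : S.Nonempty) (hQ : 1 ≤ Q) (hL : 1 ≤ L) (hAS : (#(A + S) : ℝ) ≤ L * #A)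
    (h : Good A (S - S) Q 1 p) (h' : Good A (S - S) Q 1 p') :
    Good A (S - S) (Q ^ 3 * L ^ 2) 2 (p * p') := by
  by_cases hp : p = 0
  · rw [hp, zero_mul]
    exact good_zero hA (hS.sub hS) (one_le_mul_of_one_le_of_one_le (one_le_pow₀ hQ) (one_le_pow₀ hL)) 2
  intro X
  have hW : -(S - S) = S - S := neg_sub S S
  have e1 : #(X + (p * p') • A) = #(p⁻¹ • X + p' • A) := by
    rw [← card_smul_finset₀ hp (p⁻¹ • X + _), smul_add, smul_smul, smul_smul,
      mul_inv_cancel₀ hp, one_smul]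
  have hsm : p • (S - S) = p • S - p • S := by
    rw [sub_eq_add_neg, sub_eq_add_neg, smul_add]
    congr 1
    ext x; simp [mem_smul_finset, mem_neg', eq_neg_iff_add_eq_zero]
  have e2 : #(p⁻¹ • X + (S - S)) = #((X - p • S) + p • S) := by
    rw [← card_smul_finset₀ hp (p⁻¹ • X + _), smul_add, smul_smul,
      mul_inv_cancel₀ hp, one_smul, hsm, sub_add_eq_add_sub, add_sub_assoc]
  have e3 : #((X - p • S) + (S - S)) = #(-(X + (S - S)) + p • S) := by
    rw [← card_neg (-(X + (S - S)) + p • S), neg_add, neg_neg, sub_add_eq_add_sub, sub_eq_add_neg]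
  have e4 : #(-(X + (S - S)) + (S - S)) = #(X + 2 • (S - S)) := by
    rw [← card_neg, neg_add, neg_neg, hW, two_nsmul, add_assoc]
  have f1 := h' (p⁻¹ • X)
  rw [one_nsmul] at f1
  have f2 := Good.dilS hA hp (by linarith) hAS h (X - p • S)
  have f3 := Good.dilS hA hp (by linarith) hAS h (-(X + (S - S)))
  rw [e1]
  rw [e2] at f1
  rw [e3] at f2
  rw [e4] at f3
  have hLQ : 0 ≤ L * Q := by nlinarith
  calc (#(p⁻¹ • X + p' • A) : ℝ) ≤ _ := f1
    _ ≤ Q * (L * Q * (L * Q * #(X + 2 • (S - S)))) := by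
      refine mul_le_mul_of_nonneg_left (f2.trans ?_) (by linarith)
      exact mul_le_mul_of_nonneg_left f3 hLQ
    _ = _ := by ring

lemma good_of_popular {F : Type} [Field F] [DecidableEq F] {A : Finset F} {L : ℝ} {s : F}
    (h2 : (2 : F) ≠ 0) (hA : A.Nonempty) (hL : 1 ≤ L) (hAA : (#(A + A) : ℝ) ≤ L ^ 2 * #A)
    (hs : (#A : ℝ) ≤ 4 * L ^ 2 * #(A.filter (fun y => y + s ∈ A))) :
    Good A (A.image (fun x => x ^ 2) - A.image (fun x => x ^ 2)) (4 * L ^ 4) 1 (2 * s) := by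
  set S := A.image (fun x => x ^ 2) with hS
  have hSn : S.Nonempty := hA.image _
  have hL4 : 1 ≤ L ^ 4 := one_le_pow₀ hL
  by_cases h0 : s = 0
  · rw [h0, mul_zero]
    exact good_zero hA (hSn.sub hSn) (by linarith) 1
  intro X
  rw [one_nsmul]
  set As := A.filter (fun y => y + s ∈ A) with hAs
  have hsn : 2 * s ≠ 0 := mul_ne_zero h2 h0
  have h1 := ruzsa_triangle_inequality_add_add_add X ((2 * s) • As) ((2 * s) • A)
  rw [← smul_add, card_smul_finset₀ hsn, card_smul_finset₀ hsn] at h1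
  have h3 : #(As + A) ≤ #(A + A) := card_le_card (add_subset_add_right (filter_subset _ _))
  have h4 : #(X + (2 * s) • As) ≤ #(X + (S - S)) := by
    have : (X + (2 * s) • As) ⊆ (X + (S - S)) + {-(s ^ 2)} := by
      intro x hx
      obtain ⟨y, hy, z, hz, rfl⟩ := mem_add.1 hx
      obtain ⟨a, ha, rfl⟩ := mem_smul_finset.1 hz
      rw [hAs, mem_filter] at ha
      have : y + (2 * s) • a = (y + ((a + s) ^ 2 - a ^ 2)) + -(s ^ 2) := by
        rw [smul_eq_mul]; ring
      rw [this]
      refine add_mem_add (add_mem_add hy (sub_mem_sub ?_ ?_)) (mem_singleton_self _)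
      · exact mem_image_of_mem (fun x => x ^ 2) ha.2
      · exact mem_image_of_mem (fun x => x ^ 2) ha.1
    refine (card_le_card this).trans ?_
    refine card_add_le.trans ?_
    simp
  have hA' : (0 : ℝ) < #A := by exact_mod_cast hA.card_pos
  have h5 : (#(X + (2 * s) • A) : ℝ) * #As ≤ #(X + (S - S)) * (L ^ 2 * #A) := by
    calc (#(X + (2 * s) • A) : ℝ) * #As ≤ #(X + (2 * s) • As) * #(As + A) := by exact_mod_cast h1
      _ ≤ #(X + (S - S)) * #(A + A) := by gcongr
      _ ≤ _ := by gcongr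
  have h6 : (#(X + (2 * s) • A) : ℝ) * #A ≤ (4 * L ^ 4 * #(X + (S - S))) * #A := by
    calc (#(X + (2 * s) • A) : ℝ) * #A ≤ #(X + (2 * s) • A) * (4 * L ^ 2 * #As) := by gcongr
      _ = 4 * L ^ 2 * (#(X + (2 * s) • A) * #As) := by ring
      _ ≤ 4 * L ^ 2 * (#(X + (S - S)) * (L ^ 2 * #A)) := by gcongr
      _ = _ := by ring
  exact le_of_mul_le_mul_right h6 hA'

lemma exists_popular_subset {F : Type} [Field F] [DecidableEq F] {A : Finset F} {L : ℝ}
    (hA : A.Nonempty) (hL : 1 ≤ L) (hAA : (#(A - A) : ℝ) ≤ L ^ 2 * #A) :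
    ∃ B ⊆ A, #A ≤ 2 * #B ∧ ∀ a ∈ B, ∀ b ∈ B, ∃ s t : F,
      (#A : ℝ) ≤ 4 * L ^ 2 * #(A.filter (fun y => y + s ∈ A)) ∧
      (#A : ℝ) ≤ 4 * L ^ 2 * #(A.filter (fun y => y + t ∈ A)) ∧ a - b = s - t := by
  classical
  let pop : F → Prop := fun s => (#A : ℝ) ≤ 4 * L ^ 2 * #(A.filter (fun y => y + s ∈ A))
  have hn : (0 : ℝ) < #A := by exact_mod_cast hA.card_pos
  have hL2 : 0 < L ^ 2 := by positivity
  set U := (A ×ˢ A).filter (fun x => ¬ pop (x.1 - x.2)) with hU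
  have hUcard : 4 * (#U : ℝ) ≤ #A ^ 2 := by
    have h1 : #U = ∑ d ∈ A - A, #(U.filter (fun x => x.1 - x.2 = d)) := by
      apply card_eq_sum_card_fiberwise
      intro x hx
      have hx' : x ∈ U := hx
      rw [hU, mem_filter, mem_product] at hx'
      exact sub_mem_sub hx'.1.1 hx'.1.2
    have h2 : ∀ d ∈ A - A, 4 * L ^ 2 * (#(U.filter (fun x => x.1 - x.2 = d)) : ℝ) ≤ #A := by
      intro d _
      by_cases hd : pop d
      · have : U.filter (fun x => x.1 - x.2 = d) = ∅ := by
          apply filter_false_of_mem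
          intro x hx he
          rw [hU, mem_filter, he] at hx
          exact hx.2 hd
        rw [this]; simp
      · have h3 : #(U.filter (fun x => x.1 - x.2 = d)) ≤ #(A.filter (fun y => y + d ∈ A)) := by
          apply card_le_card_of_injOn (fun x => x.2)
          · intro x hx
            have hx' := mem_filter.1 (mem_coe.1 hx)
            have hx2 := hx'.1
            rw [hU, mem_filter, mem_product] at hx2
            simp only [mem_coe, mem_filter]
            refine ⟨hx2.1.2, ?_⟩
            rw [← hx'.2, add_sub_cancel]; exact hx2.1.1
          · intro x hx y hy he
            have hx' := (mem_filter.1 (mem_coe.1 hx)).2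
            have hy' := (mem_filter.1 (mem_coe.1 hy)).2
            have he' : x.2 = y.2 := he
            refine Prod.ext ?_ he'
            linear_combination hx' - hy' + he'
        have h4 : 4 * L ^ 2 * (#(A.filter (fun y => y + d ∈ A)) : ℝ) < #A := not_le.1 hd
        refine le_trans ?_ h4.le
        gcongr
    have h5 : 4 * L ^ 2 * (#U : ℝ) ≤ #(A - A) * #A := by
      rw [h1]; push_cast
      rw [mul_sum]
      refine (sum_le_sum h2).trans ?_
      rw [sum_const, nsmul_eq_mul]
    have h6 : 4 * L ^ 2 * (#U : ℝ) ≤ L ^ 2 * #A ^ 2 := by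
      refine h5.trans ?_
      calc (#(A - A) : ℝ) * #A ≤ (L ^ 2 * #A) * #A := by gcongr
        _ = _ := by ring
    have h7 : L ^ 2 * (4 * (#U : ℝ)) ≤ L ^ 2 * #A ^ 2 := by linarith
    exact le_of_mul_le_mul_left h7 hL2
  set B := A.filter (fun a => #A < 2 * #(A.filter (fun c => pop (a - c)))) with hB
  refine ⟨B, filter_subset _ _, ?_, ?_⟩
  · have h1 : #U = ∑ a ∈ A, #(A.filter (fun c => ¬ pop (a - c))) := by
      rw [hU]; simp only [card_filter]
      rw [sum_product]
    have h2 : ∑ a ∈ A \ B, #A ≤ ∑ a ∈ A \ B, 2 * #(A.filter (fun c => ¬ pop (a - c))) := by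
      apply sum_le_sum
      intro a ha
      rw [mem_sdiff, hB, mem_filter] at ha
      have h3 := card_filter_add_card_filter_not (s := A) (fun c => pop (a - c))
      have h4 : ¬ (#A < 2 * #(A.filter (fun c => pop (a - c)))) := fun h => ha.2 ⟨ha.1, h⟩
      omega
    have h3 : ∑ a ∈ A \ B, 2 * #(A.filter (fun c => ¬ pop (a - c))) ≤ 2 * #U := by
      rw [h1, mul_sum]
      exact sum_le_sum_of_subset sdiff_subset
    have h4 : #(A \ B) * #A ≤ 2 * #U := by
      have := h2.trans h3
      rwa [sum_const, smul_eq_mul] at this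
    have h5 : (#(A \ B) : ℝ) * #A ≤ 2 * #U := by exact_mod_cast h4
    have h6 : 2 * (#(A \ B) : ℝ) ≤ #A := by
      have : (2 * (#(A \ B) : ℝ)) * #A ≤ #A * #A := by nlinarith
      exact le_of_mul_le_mul_right this hn
    have h7 : 2 * #(A \ B) ≤ #A := by exact_mod_cast h6
    have h8 := card_sdiff_add_card_eq_card (show B ⊆ A from filter_subset _ _)
    omega
  · intro a ha b hb
    have ha2 := (mem_filter.1 ha).2
    have hb2 := (mem_filter.1 hb).2
    have : ∃ c ∈ A, pop (a - c) ∧ pop (b - c) := by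
      by_contra! hc
      have hd : Disjoint (A.filter (fun c => pop (a - c))) (A.filter (fun c => pop (b - c))) := by
        rw [disjoint_filter]; exact hc
      have h1 := card_union_of_disjoint hd
      have h2 : #(A.filter (fun c => pop (a - c)) ∪ A.filter (fun c => pop (b - c))) ≤ #A :=
        card_le_card (union_subset (filter_subset _ _) (filter_subset _ _))
      omega
    obtain ⟨c, _, h1, h2⟩ := this
    exact ⟨a - c, b - c, h1, h2, by ring⟩

lemma card_le_two_mul_card_sq {F : Type} [Field F] [DecidableEq F] (A : Finset F) :
    #A ≤ 2 * #(A.image (fun x => x ^ 2)) := by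
  refine card_le_mul_card_image (f := fun x : F => x ^ 2) A 2 ?_
  intro y hy
  obtain ⟨x, hx, rfl⟩ := mem_image.1 hy
  have : (A.filter (fun z => z ^ 2 = x ^ 2)) ⊆ {x, -x} := by
    intro z hz
    have := (mem_filter.1 hz).2
    simpa using sq_eq_sq_iff_eq_or_eq_neg.1 this
  exact (card_le_card this).trans card_le_two

lemma main_bound {F : Type} [Field F] [Fintype F] [DecidableEq F] (A : Finset F)
    (h2 : (2 : F) ≠ 0) (hA : A.Nonempty)
    (hG : ∀ (G : Subfield F) (a b : F), a ≠ 0 → ∀ B ⊆ A, (∀ x ∈ B, ∃ g ∈ G, x = a * g + b) →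
      #B ^ 2 ≤ Nat.card G) :
    (#A : ℝ) ≤ 2 ^ 90 * ((#(A + A.image (fun x => x ^ 2)) : ℝ) / #A) ^ 72 := by
  set S := A.image (fun x => x ^ 2) with hS
  have hSn : S.Nonempty := hA.image _
  have hn : (0 : ℝ) < #A := by exact_mod_cast hA.card_pos
  have hSc : (#A : ℝ) ≤ 2 * #S := by exact_mod_cast card_le_two_mul_card_sq A
  set K : ℝ := (#(A + S) : ℝ) / #A with hK
  have hKn : (#(A + S) : ℝ) = K * #A := by rw [hK]; field_simp
  have hK1 : 1 ≤ K := by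
    rw [hK, le_div_iff₀ hn, one_mul]
    exact_mod_cast card_le_card_add_right hSn
  have hKdef := fun k : ℕ => congrArg (fun z : ℝ => z ^ k * (#A : ℝ)) hK
  clear_value K
  clear hK
  set L : ℝ := 2 * K with hL
  have hL1 : 1 ≤ L := by linarith
  have hAS : (#(A + S) : ℝ) ≤ L * #A := by rw [hKn, hL]; nlinarith
  have key : ∀ m : ℝ, m * #S ≤ #(A + S) * #(A + S) → 0 ≤ m → m ≤ L ^ 2 * #A := by
    intro m hm hm0
    rw [hKn] at hm
    have h3 : m * #A ≤ (L ^ 2 * #A) * #A := by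
      have : m * #A ≤ m * (2 * #S) := by gcongr
      have h4 : 0 ≤ (K * #A) * (K * #A) := by positivity
      rw [hL]; nlinarith
    exact le_of_mul_le_mul_right h3 hn
  have hAA : (#(A + A) : ℝ) ≤ L ^ 2 * #A := by
    apply key _ _ (by positivity)
    have := ruzsa_triangle_inequality_add_add_add A S A
    rw [add_comm S A] at this
    exact_mod_cast this
  have hAA' : (#(A - A) : ℝ) ≤ L ^ 2 * #A := by
    apply key _ _ (by positivity)
    have := ruzsa_triangle_inequality_sub_add_add A S A
    exact_mod_cast this
  obtain ⟨B, hBA, hBc, hBP⟩ := exists_popular_subset hA hL1 hAA'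
  by_contra! hcon
  have hK72 : 1 ≤ K ^ 72 := one_le_pow₀ hK1
  have hBc' : (#A : ℝ) ≤ 2 * #B := by exact_mod_cast hBc
  have hB2 : 2 ≤ #B := by
    have : (2 : ℝ) < #B := by linarith
    have : 2 < #B := by exact_mod_cast this
    omega
  set Q : ℝ := 4 * L ^ 4 with hQ
  have hQ1 : 1 ≤ Q := by
    have : 1 ≤ L ^ 4 := one_le_pow₀ hL1
    linarith
  have hQ0 : 0 ≤ Q := by linarith
  have hW : -(S - S) = S - S := neg_sub S S
  have hPl : ∀ k : ℕ, (#(k • (S - S)) : ℝ) ≤ K ^ (2 * k) * #A := by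
    intro k
    have h := pluennecke_ruzsa_inequality_nsmul_sub_nsmul_add hA S k k
    have h' : ((#(k • S - k • S) : ℚ≥0) : ℝ) ≤ (((#(A + S) / #A : ℚ≥0) ^ (k + k) * #A : ℚ≥0) : ℝ) := by
      exact_mod_cast h
    push_cast at h'
    have h3 := hKdef (k + k)
    rw [nsmul_sub, two_mul, h3]
    exact h'
  let P : Set F := {x | ∃ s, x = 2 * s ∧ (#A : ℝ) ≤ 4 * L ^ 2 * #(A.filter (fun y => y + s ∈ A))}
  have hPgood : ∀ p ∈ P, Good A (S - S) Q 1 p := by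
    rintro p ⟨s, rfl, hs⟩
    exact good_of_popular h2 hA hL1 hAA hs
  have hc2 : #((2 : F) • B) = #B := card_smul_finset₀ h2 B
  have bound : ∀ (Q₁ Q₂ : ℝ) (k₁ k₂ : ℕ) (u v : F), 0 ≤ Q₁ → 0 ≤ Q₂ → Good A (S - S) Q₁ k₁ u →
      Good A (S - S) Q₂ k₂ v → 4 * (Q₁ * Q₂ * K ^ (2 * (k₁ + k₂))) ≤ 2 ^ 88 * K ^ 72 →
      4 * #(u • ((2 : F) • B) + v • ((2 : F) • B)) < #((2 : F) • B) ^ 2 := by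
    intro Q₁ Q₂ k₁ k₂ u v hq1 hq2 hu hv hle
    have e1 : #(u • ((2 : F) • B) + v • ((2 : F) • B)) ≤ #(u • A + v • A) := by
      rw [smul_comm u, smul_comm v, ← smul_add, card_smul_finset₀ h2]
      exact card_le_card (add_subset_add (smul_finset_subset_smul_finset hBA)
        (smul_finset_subset_smul_finset hBA))
    have e2 := hu.pair hq1 hv
    have e3 := hPl (k₁ + k₂)
    have e4 : (#(u • ((2 : F) • B) + v • ((2 : F) • B)) : ℝ) ≤ #(u • A + v • A) := by
      exact_mod_cast e1
    have e5 : Q₁ * Q₂ * #((k₁ + k₂) • (S - S)) ≤ Q₁ * Q₂ * (K ^ (2 * (k₁ + k₂)) * #A) := by gcongr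
    rw [hc2]
    have e6 : (4 * #(u • ((2 : F) • B) + v • ((2 : F) • B)) : ℝ) < #B ^ 2 := by
      have e7 : 4 * (Q₁ * Q₂ * K ^ (2 * (k₁ + k₂))) * #A ≤ 2 ^ 88 * K ^ 72 * #A := by gcongr
      have e8 : 2 ^ 90 * K ^ 72 * #A < #A * #A := by gcongr
      have e9 : (#A : ℝ) * #A ≤ (2 * #B) * (2 * #B) := by gcongr
      nlinarith
    exact_mod_cast e6
  have kp : ∀ k ≤ 72, K ^ k ≤ K ^ 72 := fun k hk => pow_le_pow_right₀ hK1 hk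
  refine pivot ((2 : F) • B) P (by rw [hc2]; exact hB2) ?_ ?_ ?_ ?_ ?_
  · intro a ha b hb
    obtain ⟨a', ha', rfl⟩ := mem_smul_finset.1 ha
    obtain ⟨b', hb', rfl⟩ := mem_smul_finset.1 hb
    obtain ⟨s, t, hs, ht, e⟩ := hBP a' ha' b' hb'
    refine ⟨2 * s, ⟨s, rfl, hs⟩, 2 * t, ⟨t, rfl, ht⟩, ?_⟩
    simp only [smul_eq_mul]
    linear_combination 2 * e
  · intro G a b ha hx
    rw [hc2]
    refine hG G (a / 2) (b / 2) (div_ne_zero ha h2) B hBA ?_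
    intro x hxB
    obtain ⟨g, hg, e⟩ := hx (2 • x) (smul_mem_smul_finset hxB)
    refine ⟨g, hg, ?_⟩
    rw [smul_eq_mul] at e
    field_simp
    linear_combination e
  · intro p hp q hq p' hp' q' hq'
    refine bound _ _ _ _ _ _ (by positivity) (by positivity)
      ((hPgood p hp).sub hW hQ0 (hPgood q hq)) ((hPgood p' hp').sub hW hQ0 (hPgood q' hq')) ?_
    have := kp 24 (by norm_num)
    calc 4 * (Q * Q * (Q * Q) * K ^ (2 * (1 + 1 + (1 + 1)))) = 2 ^ 26 * K ^ 24 := by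
          rw [hQ, hL]; ring
      _ ≤ 2 ^ 88 * K ^ 72 := by linarith
  · intro p hp q hq p' hp' q' hq'
    refine lt_of_le_of_lt (Nat.le_mul_of_pos_left _ (by norm_num : 0 < 4)) ?_
    have g' := (hPgood p' hp').sub hW hQ0 (hPgood q' hq')
    refine bound _ _ _ _ _ _ (by positivity) (by positivity)
      (((hPgood p hp).sub hW hQ0 (hPgood q hq)).add (by positivity) g') g' ?_
    have := kp 36 (by norm_num)
    calc 4 * (Q * Q * (Q * Q) * (Q * Q) * K ^ (2 * (1 + 1 + (1 + 1) + (1 + 1))))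
        = 2 ^ 38 * K ^ 36 := by rw [hQ, hL]; ring
      _ ≤ 2 ^ 88 * K ^ 72 := by linarith
  · intro p hp q hq p' hp' q' hq' s hs t ht
    refine lt_of_le_of_lt (Nat.le_mul_of_pos_left _ (by norm_num : 0 < 4)) ?_
    have mm : ∀ x ∈ P, ∀ y ∈ P, Good A (S - S) (Q ^ 3 * L ^ 2) 2 (x * y) := fun x hx y hy =>
      Good.mul hA hSn hQ1 hL1 hAS (hPgood x hx) (hPgood y hy)
    have hq3 : 0 ≤ Q ^ 3 * L ^ 2 := by positivity
    rw [mul_sub, mul_sub]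
    refine bound _ _ _ _ _ _ (by positivity) (by positivity)
      ((mm s hs p hp).sub hW hq3 (mm s hs q hq)) ((mm t ht p' hp').sub hW hq3 (mm t ht q' hq')) ?_
    calc 4 * (Q ^ 3 * L ^ 2 * (Q ^ 3 * L ^ 2) * (Q ^ 3 * L ^ 2 * (Q ^ 3 * L ^ 2)) *
          K ^ (2 * (2 + 2 + (2 + 2)))) = 2 ^ 82 * K ^ 72 := by
          rw [hQ, hL]; ring
      _ ≤ 2 ^ 88 * K ^ 72 := by linarith

lemma two_ne_zero_of_hyp {F : Type} [Field F] [Fintype F] [DecidableEq F] (A : Finset F)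
    (hA : 2 ≤ #A)
    (hG : ∀ (G : Subfield F) (a b : F), a ≠ 0 → ∀ B ⊆ A, (∀ x ∈ B, ∃ g ∈ G, x = a * g + b) →
      #B ^ 2 ≤ Nat.card G) : (2 : F) ≠ 0 := by
  intro h2
  obtain ⟨x, hx, y, hy, hne⟩ := one_lt_card.1 (show 1 < #A from hA)
  have : CharP F 2 := CharTwo.of_one_ne_zero_of_two_eq_zero one_ne_zero h2
  have : Fact (Nat.Prime 2) := ⟨Nat.prime_two⟩
  let G : Subfield F := (frobenius F 2).eqLocusField (RingHom.id F)
  have hG1 : ∀ z ∈ G, z = 0 ∨ z = 1 := by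
    intro z hz
    have h : z ^ 2 = z := hz
    have : z * (z - 1) = 0 := by linear_combination h
    rcases mul_eq_zero.1 this with h | h
    · exact Or.inl h
    · exact Or.inr (sub_eq_zero.1 h)
  have hc : Nat.card G ≤ 2 := by
    have h1 : (G : Set F) ⊆ (({0, 1} : Finset F) : Set F) := by
      intro z hz; simpa using hG1 z hz
    have h2 := Set.ncard_le_ncard h1 (finite_toSet _)
    rw [Set.ncard_coe_finset] at h2
    exact (show Nat.card G = (G : Set F).ncard from rfl).le.trans (h2.trans card_le_two)
  have h3 := hG G (y - x) x (sub_ne_zero.2 hne.symm) {x, y} (by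
    intro z hz; rcases mem_insert.1 hz with rfl | h
    · exact hx
    · rw [mem_singleton.1 h]; exact hy) (by
    intro z hz; rcases mem_insert.1 hz with rfl | h
    · exact ⟨0, G.zero_mem, by ring⟩
    · rw [mem_singleton.1 h]; exact ⟨1, G.one_mem, by ring⟩)
  rw [card_pair hne] at h3
  omega

theorem sum_with_squares_finite_fields :
    ∃ c : ℝ, 0 < c ∧
      ∀ (F : Type) [Field F] [Fintype F] [DecidableEq F] (A : Finset F),
        (∀ (G : Subfield F) (a b : F), a ≠ 0 →
          ((((A + A : Finset F) : Set F) ∩ ((fun g => a * g + b) '' (G : Set F))).ncard : ℝ)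
            ≤ Real.sqrt (Nat.card G)) →
        c * (A.card : ℝ) ^ ((85 : ℝ) / 84)
          ≤ ((A + A.image (fun x => x ^ 2)).card : ℝ) := by
  refine ⟨1 / 2 ^ 2, by norm_num, ?_⟩
  intro F _ _ _ A hyp
  rcases A.eq_empty_or_nonempty with rfl | hA
  · simp
  have hn : (0 : ℝ) < #A := by exact_mod_cast hA.card_pos
  have hG : ∀ (G : Subfield F) (a b : F), a ≠ 0 → ∀ B ⊆ A,
      (∀ x ∈ B, ∃ g ∈ G, x = a * g + b) → #B ^ 2 ≤ Nat.card G := by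
    intro G a b ha B hBA hB
    obtain ⟨w, hw⟩ := hA
    have h1 := hyp G a (b + w) ha
    have h2 : ((B.image (fun x => x + w) : Finset F) : Set F) ⊆
        ((A + A : Finset F) : Set F) ∩ ((fun g => a * g + (b + w)) '' (G : Set F)) := by
      intro y hy
      obtain ⟨x, hx, rfl⟩ := mem_image.1 (mem_coe.1 hy)
      refine ⟨mem_coe.2 (add_mem_add (hBA hx) hw), ?_⟩
      obtain ⟨g, hg, e⟩ := hB x hx
      exact ⟨g, hg, by simp only [e]; ring⟩
    have h3 := Set.ncard_le_ncard h2 (Set.toFinite _)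
    rw [Set.ncard_coe_finset, card_image_of_injective _ (add_left_injective w)] at h3
    have h4 : (#B : ℝ) ≤ Real.sqrt (Nat.card G) := le_trans (by exact_mod_cast h3) h1
    have h5 : (#B : ℝ) ^ 2 ≤ Nat.card G := by
      rw [Real.le_sqrt (by positivity) (by positivity)] at h4
      exact h4
    exact_mod_cast h5
  have hSn : (A.image (fun x => x ^ 2)).Nonempty := hA.image _
  set N : ℝ := (#(A + A.image (fun x => x ^ 2)) : ℝ) with hN
  have hNn : (#A : ℝ) ≤ N := by
    rw [hN]; exact_mod_cast card_le_card_add_right hSn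
  have hK1 : 1 ≤ N / #A := by rwa [le_div_iff₀ hn, one_mul]
  have hmain : (#A : ℝ) ≤ 2 ^ 90 * (N / #A) ^ 72 := by
    by_cases h1 : 2 ≤ #A
    · exact main_bound A (two_ne_zero_of_hyp A h1 hG) hA hG
    · have h2 : #A ≤ 1 := by omega
      have h3 : (#A : ℝ) ≤ 1 := by exact_mod_cast h2
      have := one_le_pow₀ (n := 72) hK1
      linarith
  have h84 : (#A : ℝ) ≤ (4 * (N / #A)) ^ 84 := by
    refine hmain.trans ?_
    have : (N / #A) ^ 72 ≤ (N / #A) ^ 84 := pow_le_pow_right₀ hK1 (by norm_num)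
    rw [mul_pow]
    have h0 : 0 ≤ (N / #A) ^ 72 := by positivity
    nlinarith
  have hroot : (#A : ℝ) ^ ((1 : ℝ) / 84) ≤ 4 * (N / #A) := by
    have h0 : 0 ≤ 4 * (N / #A) := by positivity
    calc (#A : ℝ) ^ ((1 : ℝ) / 84) ≤ ((4 * (N / #A)) ^ 84) ^ ((1 : ℝ) / 84) := by gcongr
      _ = 4 * (N / #A) := by
        rw [← Real.rpow_natCast, ← Real.rpow_mul h0]; norm_num
  have hsplit : (#A : ℝ) ^ ((85 : ℝ) / 84) = #A * (#A : ℝ) ^ ((1 : ℝ) / 84) := by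
    rw [show (85 : ℝ) / 84 = 1 + 1 / 84 by norm_num, Real.rpow_add hn, Real.rpow_one]
  rw [hsplit]
  calc 1 / 2 ^ 2 * (#A * (#A : ℝ) ^ ((1 : ℝ) / 84)) ≤ 1 / 2 ^ 2 * (#A * (4 * (N / #A))) := by gcongr
    _ = N := by field_simp; norm_num
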